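/- Let n ∈ ℕ and let p be real with 0 < p < n if n is even and −1 < p < n if n is odd, and assume n − p is NOT an even integer. Then the limit lim_{ε↓0, T↑∞} ∫_ε^T (2i·sin t)^n/t^{p+1} dt exists and equals −(π/Γ(p+1)) · σ_{n,p}/ρ_{n,p}, where σ_{n,p} := Σ_{0 ≤ j < n/2} (−1)^j·C(n,j)·(n−2j)^p, and ρ_{n,p} := sin(πp/2) if n is even and ρ_{n,p} := i·cos(πp/2) if n is odd. -/

import Mathlib

open MeasureTheory Filter Set Topology
open scoped Classical

theorem sum_alternating_choose_mul_pow (n r : ℕ) (hr : r < n) :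
    ∑ j ∈ Finset.range (n + 1),
      (-1 : ℂ) ^ j * n.choose j * (((n : ℂ) - 2 * j) * Complex.I) ^ r = 0 := by
  have h := congr_fun (fwdDiff_iter_pow_eq_zero_of_lt (R := ℂ) hr) (-(n : ℂ) / 2)
  rw [fwdDiff_iter_eq_sum_shift] at h
  have h2 : ∀ j ∈ Finset.range (n + 1),
      (-1 : ℂ) ^ j * n.choose j * (((n : ℂ) - 2 * j) * Complex.I) ^ r =
      ((-1) ^ n * (-2 * Complex.I) ^ r) *
        (((-1 : ℤ) ^ (n - j) * n.choose j) • (-(n : ℂ) / 2 + j • (1 : ℂ)) ^ r) := by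
    intro j hj
    have hj : j ≤ n := Finset.mem_range_succ_iff.1 hj
    obtain ⟨k, rfl⟩ := Nat.exists_eq_add_of_le hj
    have e : (-1 : ℂ) ^ (j + k) * (-1) ^ k = (-1) ^ j := by
      rw [pow_add, mul_assoc, ← mul_pow]; simp
    have e2 : (((j + k : ℕ) : ℂ) - 2 * j) * Complex.I =
      (-2 * Complex.I) * (-((j + k : ℕ) : ℂ) / 2 + j • (1 : ℂ)) := by
      simp; ring
    rw [e2, mul_pow, ← e]
    simp
    ring
  rw [Finset.sum_congr rfl h2, ← Finset.mul_sum, h]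
  simp

theorem two_I_sin_pow (n : ℕ) (t : ℝ) :
    (2 * Complex.I * (Real.sin t : ℂ)) ^ n =
      ∑ j ∈ Finset.range (n + 1), (-1 : ℂ) ^ j * n.choose j *
        Complex.exp (((n : ℂ) - 2 * j) * Complex.I * t) := by
  have h : 2 * Complex.I * (Real.sin t : ℂ) =
      -Complex.exp (-(t * Complex.I)) + Complex.exp (t * Complex.I) := by
    rw [Complex.ofReal_sin, Complex.sin]
    rw [← neg_mul]
    linear_combination (Complex.exp (-t * Complex.I) - Complex.exp (t * Complex.I)) * Complex.I_sq
  rw [h, add_pow]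
  refine Finset.sum_congr rfl fun j hj ↦ ?_
  have hj : j ≤ n := Finset.mem_range_succ_iff.1 hj
  have : ((n : ℂ) - 2 * j) * Complex.I * t = j * (-(t * Complex.I)) + (n - j : ℕ) * (t * Complex.I) := by
    push_cast [hj]; ring
  rw [this, Complex.exp_add, Complex.exp_nat_mul, Complex.exp_nat_mul, neg_pow]
  ring

theorem integral_two_I_sin_pow_mul_exp (n : ℕ) {x : ℝ} (hx : 0 < x) (a b : ℝ) :
    ∫ t in a..b, (2 * Complex.I * (Real.sin t : ℂ)) ^ n * (Real.exp (-(x * t)) : ℂ) =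
      ∑ j ∈ Finset.range (n + 1), (-1 : ℂ) ^ j * n.choose j *
        ((Complex.exp ((((n : ℂ) - 2 * j) * Complex.I - x) * a) -
          Complex.exp ((((n : ℂ) - 2 * j) * Complex.I - x) * b)) /
          (x - ((n : ℂ) - 2 * j) * Complex.I)) := by
  have h : ∀ t : ℝ, (2 * Complex.I * (Real.sin t : ℂ)) ^ n * (Real.exp (-(x * t)) : ℂ) =
      ∑ j ∈ Finset.range (n + 1), (-1 : ℂ) ^ j * n.choose j *
        Complex.exp ((((n : ℂ) - 2 * j) * Complex.I - x) * t) := by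
    intro t
    rw [two_I_sin_pow, Finset.sum_mul]
    refine Finset.sum_congr rfl fun j _ ↦ ?_
    rw [sub_mul _ (x : ℂ), Complex.exp_sub, Complex.ofReal_exp, mul_assoc, div_eq_mul_inv,
      ← Complex.exp_neg]
    push_cast
    rfl
  simp_rw [h]
  rw [intervalIntegral.integral_finsetSum]
  · refine Finset.sum_congr rfl fun j _ ↦ ?_
    have hne : ((n : ℂ) - 2 * j) * Complex.I - x ≠ 0 := by
      intro h0
      have := congrArg Complex.re h0
      simp at this
      exact hx.ne' this
    rw [intervalIntegral.integral_const_mul, integral_exp_mul_complex hne, ← neg_sub (_ * Complex.I),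
      div_neg, ← neg_div, neg_sub]
  · intro j _
    exact Continuous.intervalIntegrable (by fun_prop) _ _

theorem pow_mul_sum_div (n r : ℕ) (hr : r ≤ n) {x : ℝ} (hx : 0 < x) :
    (x : ℂ) ^ r * ∑ j ∈ Finset.range (n + 1), (-1 : ℂ) ^ j * n.choose j *
        (1 / (x - ((n : ℂ) - 2 * j) * Complex.I)) =
    ∑ j ∈ Finset.range (n + 1), (-1 : ℂ) ^ j * n.choose j *
        ((((n : ℂ) - 2 * j) * Complex.I) ^ r / (x - ((n : ℂ) - 2 * j) * Complex.I)) := by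
  induction r with
  | zero => simp
  | succ r ih =>
    rw [pow_succ', mul_assoc, ih (by omega), Finset.mul_sum, ← sub_eq_zero, ← Finset.sum_sub_distrib,
      ← sum_alternating_choose_mul_pow n r (by omega)]
    refine Finset.sum_congr rfl fun j _ ↦ ?_
    have hne : (x : ℂ) - ((n : ℂ) - 2 * j) * Complex.I ≠ 0 := by
      intro h0
      have := congrArg Complex.re h0
      simp at this
      exact hx.ne' this
    field_simp
    ring

theorem sum_range_eq_zero_of_antisymm {n : ℕ} {F : ℕ → ℂ} (hF : ∀ j ≤ n, F (n - j) = -F j) :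
    ∑ j ∈ Finset.range (n + 1), F j = 0 := by
  have h := Finset.sum_range_reflect F (n + 1)
  have h2 : ∑ j ∈ Finset.range (n + 1), F (n + 1 - 1 - j) = ∑ j ∈ Finset.range (n + 1), -F j :=
    Finset.sum_congr rfl fun j hj ↦ hF j (Finset.mem_range_succ_iff.1 hj)
  rw [h2, Finset.sum_neg_distrib] at h
  exact CharZero.eq_neg_self_iff.1 h.symm

theorem sum_range_eq_two_mul_of_symm {n : ℕ} {F : ℕ → ℂ} (hF : ∀ j ≤ n, F (n - j) = F j)
    (h0 : ∀ j, 2 * j = n → F j = 0) :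
    ∑ j ∈ Finset.range (n + 1), F j = 2 * ∑ j ∈ Finset.range ((n + 1) / 2), F j := by
  have h1 : ∑ j ∈ Finset.range (n + 1) with n < 2 * j, F j =
      ∑ j ∈ Finset.range ((n + 1) / 2), F j := by
    refine Finset.sum_nbij' (fun j ↦ n - j) (fun j ↦ n - j) ?_ ?_ ?_ ?_ ?_
    · intro j hj; simp at hj ⊢; omega
    · intro j hj; simp at hj ⊢; omega
    · intro j hj; simp at hj ⊢; omega
    · intro j hj; simp at hj ⊢; omega
    · intro j hj; simp at hj; exact (hF j (by omega)).symm
  have h2 : ∑ j ∈ Finset.range (n + 1) with ¬ n < 2 * j, F j =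
      ∑ j ∈ Finset.range ((n + 1) / 2), F j := by
    symm
    refine Finset.sum_subset ?_ ?_
    · intro j hj; simp at hj ⊢; omega
    · intro j hj hj'
      simp at hj hj'
      exact h0 j (by omega)
  rw [← Finset.sum_filter_add_sum_filter_not _ (fun j ↦ n < 2 * j), h1, h2, two_mul]

theorem integrableOn_and_integral_rpow_div_sq_add_sq {q m : ℝ} (hq : -1 < q) (hq' : q < 1)
    (hm : 0 < m) :
    IntegrableOn (fun x : ℝ ↦ x ^ q / (x ^ 2 + m ^ 2)) (Ioi 0) ∧
      ∫ x in Ioi (0 : ℝ), x ^ q / (x ^ 2 + m ^ 2) =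
        m ^ (q - 1) * (Real.pi / (2 * Real.cos (Real.pi * q / 2))) := by
  set F : ℝ → ℝ → ℝ := fun x s ↦ x ^ q * Real.exp (-((x ^ 2 + m ^ 2) * s)) with hF
  have hsplit : ∀ x s : ℝ, F x s = Real.exp (-(m ^ 2 * s)) * (x ^ q * Real.exp (-s * x ^ (2 : ℝ))) := by
    intro x s
    simp only [hF, Real.rpow_two]
    rw [mul_left_comm, ← Real.exp_add]
    ring_nf
  have hx : ∀ s ∈ Ioi (0 : ℝ), ∫ x in Ioi (0 : ℝ), F x s =
      (1 / 2 * Real.Gamma ((q + 1) / 2)) * (s ^ ((1 - q) / 2 - 1) * Real.exp (-(m ^ 2 * s))) := by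
    intro s hs
    simp_rw [hsplit]
    rw [integral_const_mul, integral_rpow_mul_exp_neg_mul_rpow two_pos hq hs,
      show (1 - q) / 2 - 1 = -(q + 1) / 2 by ring]
    ring
  have hs : ∀ x ∈ Ioi (0 : ℝ), ∫ s in Ioi (0 : ℝ), F x s = x ^ q / (x ^ 2 + m ^ 2) := by
    intro x hx
    have h := Real.integral_rpow_mul_exp_neg_mul_Ioi one_pos (show 0 < x ^ 2 + m ^ 2 by positivity)
    simp only [sub_self, Real.rpow_zero, one_mul, Real.rpow_one, Real.Gamma_one, mul_one] at h
    rw [integral_const_mul, h, mul_one_div]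
  have hmeas : Measurable (Function.uncurry F) := by
    simp only [hF, Function.uncurry_def]
    fun_prop
  have hint : Integrable (Function.uncurry F)
      ((volume.restrict (Ioi 0)).prod (volume.restrict (Ioi 0))) := by
    rw [integrable_prod_iff' hmeas.aestronglyMeasurable]
    refine ⟨?_, ?_⟩
    · refine (ae_restrict_iff' measurableSet_Ioi).2 (Eventually.of_forall fun s hs ↦ ?_)
      simp only [Function.uncurry_apply_pair, hsplit]
      exact (integrableOn_rpow_mul_exp_neg_mul_rpow hq two_pos hs).const_mul _
    · have hI : IntegrableOn (fun s : ℝ ↦ (1 / 2 * Real.Gamma ((q + 1) / 2)) *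
          (s ^ ((1 - q) / 2 - 1) * Real.exp (-(m ^ 2 * s)))) (Ioi 0) := by
        have := integrableOn_rpow_mul_exp_neg_mul_rpow (p := 1) (s := (1 - q) / 2 - 1)
          (b := m ^ 2) (by linarith) one_pos (by positivity)
        simp only [Real.rpow_one, neg_mul] at this
        exact this.const_mul _
      refine hI.congr_fun (fun s hs ↦ ?_) measurableSet_Ioi
      dsimp only
      rw [← hx s hs]
      refine setIntegral_congr_fun measurableSet_Ioi fun x hx ↦ ?_
      have : 0 ≤ F x s := mul_nonneg (Real.rpow_nonneg (le_of_lt hx) _) (Real.exp_nonneg _)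
      simp [abs_of_nonneg this]
  refine ⟨?_, ?_⟩
  · have := hint.integral_prod_left
    exact IntegrableOn.congr_fun this hs measurableSet_Ioi
  · rw [← setIntegral_congr_fun measurableSet_Ioi hs, integral_integral_swap hint,
      setIntegral_congr_fun measurableSet_Ioi hx, integral_const_mul,
      Real.integral_rpow_mul_exp_neg_mul_Ioi (by linarith) (by positivity)]
    have hG := Real.Gamma_mul_Gamma_one_sub ((q + 1) / 2)
    rw [show 1 - (q + 1) / 2 = (1 - q) / 2 by ring,
      show Real.pi * ((q + 1) / 2) = Real.pi * q / 2 + Real.pi / 2 by ring,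
      Real.sin_add_pi_div_two] at hG
    have hpow : (1 / m ^ 2) ^ ((1 - q) / 2) = m ^ (q - 1) := by
      rw [one_div, Real.inv_rpow (by positivity), ← Real.rpow_natCast m 2, ← Real.rpow_mul hm.le,
        ← Real.rpow_neg hm.le]
      congr 1
      push_cast
      ring
    rw [hpow, mul_comm 2, ← div_div, ← hG]
    ring

theorem Gamma_mul_integral_two_I_sin_pow_div (n : ℕ) {p a b : ℝ} (hp : -1 < p) (ha : 0 < a)
    (hab : a ≤ b) :
    (Real.Gamma (p + 1) : ℂ) *
      ∫ t in a..b, (2 * Complex.I * (Real.sin t : ℂ)) ^ n / ((t ^ (p + 1) : ℝ) : ℂ) =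
    ∫ x in Ioi (0 : ℝ), ((x ^ p : ℝ) : ℂ) *
      ∫ t in a..b, (2 * Complex.I * (Real.sin t : ℂ)) ^ n * (Real.exp (-(x * t)) : ℂ) := by
  set f : ℝ → ℂ := fun t ↦ (2 * Complex.I * (Real.sin t : ℂ)) ^ n with hf
  set F : ℝ → ℝ → ℂ := fun t x ↦ f t * ((x ^ p * Real.exp (-(t * x)) : ℝ) : ℂ) with hF
  have hfc : Continuous f := by fun_prop
  have hmeas : Measurable (Function.uncurry F) := by
    simp only [hF, Function.uncurry_def]
    fun_prop
  have hΓ : ∀ t ∈ Ioc a b, ∫ x in Ioi (0 : ℝ), x ^ p * Real.exp (-(t * x)) =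
      Real.Gamma (p + 1) / t ^ (p + 1) := by
    intro t ht
    have ht0 : 0 < t := ha.trans ht.1
    have h := Real.integral_rpow_mul_exp_neg_mul_Ioi (show 0 < p + 1 by linarith) ht0
    rw [add_sub_cancel_right] at h
    rw [h, one_div, Real.inv_rpow ht0.le]
    ring
  have hint : Integrable (Function.uncurry F)
      ((volume.restrict (Ioc a b)).prod (volume.restrict (Ioi 0))) := by
    rw [integrable_prod_iff hmeas.aestronglyMeasurable]
    refine ⟨?_, ?_⟩
    · refine (ae_restrict_iff' measurableSet_Ioc).2 (Eventually.of_forall fun t ht ↦ ?_)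
      have := integrableOn_rpow_mul_exp_neg_mul_rpow (p := 1) (s := p)
          (b := t) hp one_pos (ha.trans ht.1)
      simp only [Real.rpow_one, neg_mul] at this
      exact (Integrable.ofReal (𝕜 := ℂ) this).const_mul (f t)
    · have hI : IntegrableOn (fun t : ℝ ↦ ‖f t‖ * (Real.Gamma (p + 1) / t ^ (p + 1)))
          (Ioc a b) := by
        refine (ContinuousOn.integrableOn_Icc ?_).mono_set Ioc_subset_Icc_self
        refine hfc.norm.continuousOn.mul (continuousOn_const.div ?_ ?_)
        · exact continuousOn_id.rpow_const fun t ht ↦ Or.inl (ha.trans_le ht.1).ne'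
        · exact fun t ht ↦ (Real.rpow_pos_of_pos (ha.trans_le ht.1) _).ne'
      refine hI.congr_fun (fun t ht ↦ ?_) measurableSet_Ioc
      simp only
      rw [← hΓ t ht, ← integral_const_mul]
      refine setIntegral_congr_fun measurableSet_Ioi fun x hx ↦ ?_
      have : 0 ≤ x ^ p * Real.exp (-(t * x)) :=
        mul_nonneg (Real.rpow_nonneg (le_of_lt hx) _) (Real.exp_nonneg _)
      simp only [hF, Function.uncurry_apply_pair, norm_mul, Complex.norm_real, Real.norm_eq_abs]
      rw [← abs_mul, abs_of_nonneg this]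
  have h := integral_integral_swap hint
  rw [intervalIntegral.integral_of_le hab, ← integral_const_mul]
  trans ∫ t in Ioc a b, ∫ x in Ioi (0 : ℝ), F t x
  · refine setIntegral_congr_fun measurableSet_Ioc fun t ht ↦ ?_
    simp only [hF, hf]
    rw [integral_const_mul, integral_complex_ofReal, hΓ t ht]
    push_cast
    ring
  · rw [h]
    refine setIntegral_congr_fun measurableSet_Ioi fun x hx ↦ ?_
    simp only [intervalIntegral.integral_of_le hab, hF, hf]
    rw [← integral_const_mul]
    refine integral_congr_ae (Eventually.of_forall fun t ↦ ?_)
    simp only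
    rw [mul_comm t x]
    push_cast
    ring

theorem norm_integral_two_I_sin_pow_mul_exp_le (n : ℕ) {x a b δ : ℝ} (hx : 0 < x) (ha : 0 ≤ a)
    (hb : 0 ≤ b) (hδ : 0 < δ)
    (h : ∀ j : ℕ, δ ≤ ‖(x : ℂ) - ((n : ℂ) - 2 * j) * Complex.I‖) :
    ‖∫ t in a..b, (2 * Complex.I * (Real.sin t : ℂ)) ^ n * (Real.exp (-(x * t)) : ℂ)‖ ≤
      2 ^ (n + 1) / δ := by
  have hexp : ∀ (j : ℕ) (t : ℝ), 0 ≤ t →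
      ‖Complex.exp ((((n : ℂ) - 2 * j) * Complex.I - x) * t)‖ ≤ 1 := by
    intro j t ht
    rw [Complex.norm_exp, Real.exp_le_one_iff]
    simp
    positivity
  rw [integral_two_I_sin_pow_mul_exp n hx]
  calc _ ≤ ∑ j ∈ Finset.range (n + 1), (n.choose j : ℝ) * (2 / δ) := by
        refine (norm_sum_le _ _).trans (Finset.sum_le_sum fun j _ ↦ ?_)
        rw [norm_mul, norm_div, norm_mul, norm_pow, norm_neg, norm_one, one_pow, one_mul,
          Complex.norm_natCast]
        gcongr
        · exact (norm_sub_le _ _).trans (by linarith [hexp j a ha, hexp j b hb])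
        · exact h j
    _ = 2 ^ (n + 1) / δ := by
        rw [← Finset.sum_mul, ← Nat.cast_sum, Nat.sum_range_choose]
        push_cast
        ring

theorem norm_integral_two_I_sin_pow_mul_exp_le_Gamma (n : ℕ) {x a b : ℝ} (hx : 0 < x) (ha : 0 ≤ a)
    (hab : a ≤ b) :
    ‖∫ t in a..b, (2 * Complex.I * (Real.sin t : ℂ)) ^ n * (Real.exp (-(x * t)) : ℂ)‖ ≤
      2 ^ n * Real.Gamma (n + 1) * x ^ (-(n + 1 : ℝ)) := by
  have hI := (integrableOn_rpow_mul_exp_neg_mul_rpow (p := 1) (s := n) (b := x)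
    (by linarith [Nat.cast_nonneg (α := ℝ) n]) one_pos hx)
  simp only [Real.rpow_one, neg_mul, Real.rpow_natCast] at hI
  replace hI : IntegrableOn (fun t : ℝ ↦ 2 ^ n * (t ^ n * Real.exp (-(x * t)))) (Ioi 0) :=
    hI.const_mul (2 ^ n)
  have hsub : Ioc a b ⊆ Ioi 0 := fun t ht ↦ ha.trans_lt ht.1
  rw [intervalIntegral.integral_of_le hab]
  calc _ ≤ ∫ t in Ioc a b, 2 ^ n * (t ^ n * Real.exp (-(x * t))) := by
        refine norm_integral_le_of_norm_le (hI.mono_set hsub) ?_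
        refine (ae_restrict_iff' measurableSet_Ioc).2 (Eventually.of_forall fun t ht ↦ ?_)
        have ht0 : 0 < t := hsub ht
        simp only [norm_mul, norm_pow, Complex.norm_I, Complex.norm_real, mul_one, mul_pow, one_pow,
          Complex.norm_ofNat, Real.norm_eq_abs, Real.abs_exp]
        rw [mul_assoc]
        gcongr
        exact (Real.abs_sin_lt_abs ht0.ne').le.trans_eq (abs_of_pos ht0)
    _ ≤ ∫ t in Ioi 0, 2 ^ n * (t ^ n * Real.exp (-(x * t))) := by
        refine setIntegral_mono_set hI ?_ (Eventually.of_forall hsub)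
        refine (ae_restrict_iff' measurableSet_Ioi).2 (Eventually.of_forall fun t ht ↦ ?_)
        have ht0 : (0 : ℝ) < t := ht
        simp only [Pi.zero_apply]
        positivity
    _ = _ := by
        have h := Real.integral_rpow_mul_exp_neg_mul_Ioi
          (show (0 : ℝ) < n + 1 by positivity) hx
        simp only [add_sub_cancel_right, Real.rpow_natCast] at h
        rw [integral_const_mul, h, one_div, Real.inv_rpow hx.le, ← Real.rpow_neg hx.le]
        ring

theorem le_norm_ofReal_sub_mul_I (x y : ℝ) (hx : 0 ≤ x) :
    x ≤ ‖(x : ℂ) - y * Complex.I‖ ∧ |y| ≤ ‖(x : ℂ) - y * Complex.I‖ := by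
  constructor
  · simpa [abs_of_nonneg hx] using Complex.abs_re_le_norm ((x : ℂ) - y * Complex.I)
  · simpa using Complex.abs_im_le_norm ((x : ℂ) - y * Complex.I)

theorem one_le_abs_sub_two_mul {n : ℕ} (hn : Odd n) (j : ℕ) : 1 ≤ |(n : ℝ) - 2 * j| := by
  have h : (n : ℤ) - 2 * j ≠ 0 := by
    obtain ⟨k, rfl⟩ := hn
    omega
  exact_mod_cast Int.one_le_abs h

theorem norm_integral_two_I_sin_pow_mul_exp_le_rpow (n : ℕ) {x a b : ℝ} (hx : 0 < x) (ha : 0 ≤ a)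
    (hb : 0 ≤ b) :
    ‖∫ t in a..b, (2 * Complex.I * (Real.sin t : ℂ)) ^ n * (Real.exp (-(x * t)) : ℂ)‖ ≤
      2 ^ (n + 1) * x ^ (if Even n then (-1 : ℝ) else 0) := by
  have hle : ∀ j : ℕ, _ := fun j ↦ le_norm_ofReal_sub_mul_I x ((n : ℝ) - 2 * j) hx.le
  push_cast at hle
  split_ifs with h
  · rw [Real.rpow_neg_one, ← div_eq_mul_inv]
    exact norm_integral_two_I_sin_pow_mul_exp_le n hx ha hb hx fun j ↦ (hle j).1
  · have := norm_integral_two_I_sin_pow_mul_exp_le n hx ha hb one_pos fun j ↦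
      (one_le_abs_sub_two_mul (Nat.not_even_iff_odd.1 h) j).trans (hle j).2
    simpa using this

theorem tendsto_integral_two_I_sin_pow_mul_exp (n : ℕ) {x : ℝ} (hx : 0 < x) :
    Tendsto (fun s : ℝ × ℝ ↦
        ∫ t in s.1..s.2, (2 * Complex.I * (Real.sin t : ℂ)) ^ n * (Real.exp (-(x * t)) : ℂ))
      ((𝓝[>] (0:ℝ)) ×ˢ atTop)
      (𝓝 (∑ j ∈ Finset.range (n + 1), (-1 : ℂ) ^ j * n.choose j *
        (1 / (x - ((n : ℂ) - 2 * j) * Complex.I)))) := by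
  simp_rw [integral_two_I_sin_pow_mul_exp n hx]
  refine tendsto_finsetSum _ fun j _ ↦ Tendsto.const_mul _ (Tendsto.div_const ?_ _)
  rw [← sub_zero (1 : ℂ)]
  refine Tendsto.sub ?_ ?_
  · have hc : Continuous fun a : ℝ ↦ Complex.exp ((((n : ℂ) - 2 * j) * Complex.I - x) * a) := by
      fun_prop
    have := hc.tendsto 0
    simp only [Complex.ofReal_zero, mul_zero, Complex.exp_zero] at this
    exact (this.mono_left nhdsWithin_le_nhds).comp tendsto_fst
  · refine Tendsto.comp (g := fun b : ℝ ↦ Complex.exp ((((n : ℂ) - 2 * j) * Complex.I - x) * b))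
      ?_ tendsto_snd
    rw [tendsto_zero_iff_norm_tendsto_zero]
    have h : ∀ b : ℝ, ‖Complex.exp ((((n : ℂ) - 2 * j) * Complex.I - x) * b)‖ =
        Real.exp (-(x * b)) := by
      intro b
      rw [Complex.norm_exp]
      simp
    simp_rw [h]
    exact Real.tendsto_exp_neg_atTop_nhds_zero.comp (tendsto_id.const_mul_atTop hx)

theorem eventually_pos_and_le :
    ∀ᶠ s : ℝ × ℝ in (𝓝[>] (0:ℝ)) ×ˢ atTop, 0 < s.1 ∧ s.1 ≤ s.2 := by
  have h1 : ∀ᶠ a : ℝ in 𝓝[>] 0, 0 < a ∧ a ≤ 1 := by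
    filter_upwards [Ioc_mem_nhdsGT (zero_lt_one (α := ℝ))] with a ha using ha
  filter_upwards [h1.prod_mk (eventually_ge_atTop (1 : ℝ))] with s hs
  exact ⟨hs.1.1, hs.1.2.trans hs.2⟩

theorem tendsto_integral_rpow_mul_integral_two_I_sin_pow_mul_exp (n : ℕ) {p : ℝ}
    (hpe : Even n → 0 < p) (hpo : Odd n → -1 < p) (hpn : p < n) :
    Tendsto (fun s : ℝ × ℝ ↦ ∫ x in Ioi (0 : ℝ), ((x ^ p : ℝ) : ℂ) *
        ∫ t in s.1..s.2, (2 * Complex.I * (Real.sin t : ℂ)) ^ n * (Real.exp (-(x * t)) : ℂ))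
      ((𝓝[>] (0:ℝ)) ×ˢ atTop)
      (𝓝 (∫ x in Ioi (0 : ℝ), ((x ^ p : ℝ) : ℂ) *
        ∑ j ∈ Finset.range (n + 1), (-1 : ℂ) ^ j * n.choose j *
          (1 / (x - ((n : ℂ) - 2 * j) * Complex.I)))) := by
  set e : ℝ := if Even n then -1 else 0 with he
  have hpe' : -1 < p + e := by
    rw [he]
    split_ifs with h
    · linarith [hpe h]
    · linarith [hpo (Nat.not_even_iff_odd.1 h)]
  set B : ℝ → ℝ := (Ioc (0 : ℝ) 1).piecewise (fun x ↦ 2 ^ (n + 1) * x ^ (p + e))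
    (fun x ↦ 2 ^ n * Real.Gamma (n + 1) * x ^ (p - (n + 1))) with hB
  have hBint : IntegrableOn B (Ioi 0) := by
    rw [← Ioc_union_Ioi_eq_Ioi zero_le_one]
    refine IntegrableOn.union ?_ ?_
    · have : IntegrableOn (fun x : ℝ ↦ 2 ^ (n + 1) * x ^ (p + e)) (Ioc 0 1) :=
        ((intervalIntegrable_iff_integrableOn_Ioc_of_le zero_le_one).1
          (intervalIntegral.intervalIntegrable_rpow' hpe')).const_mul _
      exact this.congr_fun (fun x hx ↦ by simp [hB, hx]) measurableSet_Ioc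
    · have : IntegrableOn (fun x : ℝ ↦ 2 ^ n * Real.Gamma (n + 1) * x ^ (p - (n + 1))) (Ioi 1) :=
        (integrableOn_Ioi_rpow_of_lt (by linarith) one_pos).const_mul _
      refine this.congr_fun (fun x hx ↦ ?_) measurableSet_Ioi
      have : x ∉ Ioc (0 : ℝ) 1 := fun h ↦ (not_le_of_gt hx) h.2
      simp [hB, this]
  refine tendsto_integral_filter_of_dominated_convergence B ?_ ?_ hBint ?_
  · refine Eventually.of_forall fun s ↦ ?_
    have hm : AEStronglyMeasurable (fun x : ℝ ↦ ((x ^ p : ℝ) : ℂ) *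
        ∑ j ∈ Finset.range (n + 1), (-1 : ℂ) ^ j * n.choose j *
        ((Complex.exp ((((n : ℂ) - 2 * j) * Complex.I - x) * s.1) -
          Complex.exp ((((n : ℂ) - 2 * j) * Complex.I - x) * s.2)) /
          (x - ((n : ℂ) - 2 * j) * Complex.I))) (volume.restrict (Ioi 0)) :=
      Measurable.aestronglyMeasurable (by fun_prop)
    refine hm.congr ?_
    refine (ae_restrict_iff' measurableSet_Ioi).2 (Eventually.of_forall fun x hx ↦ ?_)
    simp only [integral_two_I_sin_pow_mul_exp n hx]
  · filter_upwards [eventually_pos_and_le] with s hs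
    refine (ae_restrict_iff' measurableSet_Ioi).2 (Eventually.of_forall fun x hx ↦ ?_)
    have hx0 : (0 : ℝ) < x := hx
    rw [norm_mul, Complex.norm_real, Real.norm_eq_abs, abs_of_pos (Real.rpow_pos_of_pos hx0 _)]
    by_cases hx1 : x ∈ Ioc (0 : ℝ) 1
    · rw [hB, piecewise_eq_of_mem _ _ _ hx1, Real.rpow_add hx0, mul_left_comm]
      gcongr
      exact norm_integral_two_I_sin_pow_mul_exp_le_rpow n hx0 hs.1.le (hs.1.le.trans hs.2)
    · rw [hB, piecewise_eq_of_notMem _ _ _ hx1, sub_eq_add_neg, Real.rpow_add hx0, mul_left_comm]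
      gcongr
      exact norm_integral_two_I_sin_pow_mul_exp_le_Gamma n hx0 hs.1.le hs.2
  · refine (ae_restrict_iff' measurableSet_Ioi).2 (Eventually.of_forall fun x hx ↦ ?_)
    exact (tendsto_integral_two_I_sin_pow_mul_exp n hx).const_mul _

theorem neg_one_pow_mul_choose_reflect {n j : ℕ} (hj : j ≤ n) :
    (-1 : ℂ) ^ (n - j) * n.choose (n - j) = (-1) ^ n * ((-1) ^ j * n.choose j) ∧
      (n : ℂ) - 2 * (n - j : ℕ) = -((n : ℂ) - 2 * j) ∧
      |(n : ℝ) - 2 * (n - j : ℕ)| = |(n : ℝ) - 2 * j| := by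
  obtain ⟨i, rfl⟩ := Nat.exists_eq_add_of_le hj
  refine ⟨?_, ?_, ?_⟩
  · have e : (-1 : ℂ) ^ (j + i) * (-1) ^ j = (-1) ^ i := by
      rw [pow_add, mul_right_comm, ← mul_pow]; simp
    rw [Nat.choose_symm hj, Nat.add_sub_cancel_left, ← e]
    ring
  · push_cast [hj]; ring
  · rw [← abs_neg]
    congr 1
    push_cast [hj]
    ring

theorem pow_two_mul_mul_sum_div (n k : ℕ) (hk : 2 * k ≤ n) {x : ℝ} (hx : 0 < x) :
    (x : ℂ) ^ (2 * k) * ∑ j ∈ Finset.range (n + 1), (-1 : ℂ) ^ j * n.choose j *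
        (1 / (x - ((n : ℂ) - 2 * j) * Complex.I)) =
      if Even n then
        ∑ j ∈ Finset.range (n + 1), (-1 : ℂ) ^ j * n.choose j * (-1) ^ k *
          ((n : ℂ) - 2 * j) ^ (2 * k) * (x / (x ^ 2 + ((n : ℂ) - 2 * j) ^ 2))
      else
        ∑ j ∈ Finset.range (n + 1), (-1 : ℂ) ^ j * n.choose j * (-1) ^ k *
          ((n : ℂ) - 2 * j) ^ (2 * k) * (((n : ℂ) - 2 * j) * Complex.I /
            (x ^ 2 + ((n : ℂ) - 2 * j) ^ 2)) := by
  have hterm : ∀ j : ℕ, (((n : ℂ) - 2 * j) * Complex.I) ^ (2 * k) /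
      (x - ((n : ℂ) - 2 * j) * Complex.I) = (-1) ^ k * ((n : ℂ) - 2 * j) ^ (2 * k) *
        (x / (x ^ 2 + ((n : ℂ) - 2 * j) ^ 2)) + (-1) ^ k * ((n : ℂ) - 2 * j) ^ (2 * k) *
        (((n : ℂ) - 2 * j) * Complex.I / (x ^ 2 + ((n : ℂ) - 2 * j) ^ 2)) := by
    intro j
    have h1 : (x : ℂ) - ((n : ℂ) - 2 * j) * Complex.I ≠ 0 := by
      intro h0
      have := congrArg Complex.re h0
      simp at this
      exact hx.ne' this
    have h2 : (x : ℂ) ^ 2 + ((n : ℂ) - 2 * j) ^ 2 ≠ 0 := by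
      have : (x : ℝ) ^ 2 + ((n : ℝ) - 2 * j) ^ 2 ≠ 0 := by positivity
      exact_mod_cast this
    have h3 : 1 / ((x : ℂ) - ((n : ℂ) - 2 * j) * Complex.I) =
        (x + ((n : ℂ) - 2 * j) * Complex.I) / (x ^ 2 + ((n : ℂ) - 2 * j) ^ 2) := by
      rw [div_eq_div_iff h1 h2]
      linear_combination ((n : ℂ) - 2 * j) ^ 2 * Complex.I_sq
    rw [mul_pow, pow_mul Complex.I, Complex.I_sq, div_eq_mul_one_div, h3]
    ring
  rw [pow_mul_sum_div n _ hk hx]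
  simp_rw [hterm, mul_add, Finset.sum_add_distrib, ← mul_assoc]
  have hrefl : ∀ j ≤ n, _ := fun j hj ↦ neg_one_pow_mul_choose_reflect hj
  split_ifs with h
  · rw [add_eq_left]
    refine sum_range_eq_zero_of_antisymm fun j hj ↦ ?_
    rw [(hrefl j hj).1, (hrefl j hj).2.1, h.neg_one_pow, (even_two_mul k).neg_pow, neg_sq]
    ring
  · rw [add_eq_right]
    refine sum_range_eq_zero_of_antisymm fun j hj ↦ ?_
    rw [(hrefl j hj).1, (hrefl j hj).2.1, (Nat.not_even_iff_odd.1 h).neg_one_pow,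
      (even_two_mul k).neg_pow, neg_sq]
    ring

theorem integral_sum_mul_rpow_div_sq_add_sq {q : ℝ} (hq : -1 < q) (hq' : q < 1) (s : Finset ℕ)
    (w : ℕ → ℂ) (y : ℕ → ℝ) (h : ∀ j ∈ s, y j = 0 → w j = 0) :
    ∫ x in Ioi (0 : ℝ), ∑ j ∈ s, w j * ((x ^ q / (x ^ 2 + y j ^ 2) : ℝ) : ℂ) =
      ∑ j ∈ s, w j *
        ((|y j| ^ (q - 1) * (Real.pi / (2 * Real.cos (Real.pi * q / 2))) : ℝ) : ℂ) := by
  have key : ∀ j ∈ s, y j ≠ 0 → _ := fun j _ hj ↦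
    integrableOn_and_integral_rpow_div_sq_add_sq hq hq' (abs_pos.2 hj)
  simp only [sq_abs] at key
  rw [integral_finsetSum]
  · refine Finset.sum_congr rfl fun j hj ↦ ?_
    by_cases h0 : y j = 0
    · simp [h j hj h0]
    · rw [integral_const_mul, integral_complex_ofReal, (key j hj h0).2]
  · intro j hj
    by_cases h0 : y j = 0
    · simp [h j hj h0]
    · exact (Integrable.ofReal (𝕜 := ℂ) (key j hj h0).1).const_mul (w j)

theorem integral_rpow_mul_sum_of_odd {n : ℕ} (hn : Odd n) {p : ℝ} (hp : -1 < p) (hpn : p < n)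
    (hne : ¬∃ k : ℤ, (n : ℝ) - p = 2 * k) :
    ∫ x in Ioi (0 : ℝ), ((x ^ p : ℝ) : ℂ) *
        ∑ j ∈ Finset.range (n + 1), (-1 : ℂ) ^ j * n.choose j *
          (1 / (x - ((n : ℂ) - 2 * j) * Complex.I)) =
      Complex.I * ((Real.pi / Real.cos (Real.pi * p / 2) : ℝ) : ℂ) *
        ((∑ j ∈ Finset.range ((n + 1) / 2),
              (-1 : ℝ) ^ j * (n.choose j) * ((n : ℝ) - 2 * j) ^ p : ℝ) : ℂ) := by
  obtain ⟨k, hk⟩ : ∃ k : ℕ, k = ⌊(p + 1) / 2⌋₊ := ⟨_, rfl⟩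
  have hk1 : (k : ℝ) ≤ (p + 1) / 2 := hk ▸ Nat.floor_le (by linarith)
  have hk2 : (p + 1) / 2 < k + 1 := hk ▸ Nat.lt_floor_add_one _
  obtain ⟨q, hq⟩ : ∃ q, q = p - 2 * k := ⟨_, rfl⟩
  have hq1 : -1 < q := by
    refine lt_of_le_of_ne (by linarith) fun h ↦ hne ?_
    obtain ⟨m, hm⟩ := hn
    exact ⟨m + 1 - k, by rw [hm]; push_cast; linarith⟩
  have hkn : 2 * k ≤ n := by
    have : (2 * k : ℝ) < n + 1 := by linarith
    have : 2 * k < n + 1 := by exact_mod_cast this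
    omega
  have hy : ∀ j : ℕ, (n : ℝ) - 2 * j ≠ 0 := fun j h0 ↦ by
    have := one_le_abs_sub_two_mul hn j
    rw [h0] at this
    norm_num at this
  have hI : ∀ x ∈ Ioi (0 : ℝ), ((x ^ p : ℝ) : ℂ) *
        ∑ j ∈ Finset.range (n + 1), (-1 : ℂ) ^ j * n.choose j *
          (1 / (x - ((n : ℂ) - 2 * j) * Complex.I)) =
      ∑ j ∈ Finset.range (n + 1), ((-1 : ℂ) ^ j * n.choose j * (-1) ^ k *
          ((n : ℂ) - 2 * j) ^ (2 * k) * (((n : ℂ) - 2 * j) * Complex.I)) *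
          ((x ^ q / (x ^ 2 + ((n : ℝ) - 2 * j) ^ 2) : ℝ) : ℂ) := by
    intro x hx
    have hx0 : (0 : ℝ) < x := hx
    have hxp : x ^ p = x ^ q * x ^ (2 * k) := by
      rw [← Real.rpow_natCast x, ← Real.rpow_add hx0, hq]
      push_cast
      ring_nf
    rw [hxp]
    push_cast
    rw [mul_assoc, pow_two_mul_mul_sum_div n k hkn hx0, if_neg (Nat.not_even_iff_odd.2 hn),
      Finset.mul_sum]
    refine Finset.sum_congr rfl fun j _ ↦ ?_
    ring
  rw [setIntegral_congr_fun measurableSet_Ioi hI, integral_sum_mul_rpow_div_sq_add_sq hq1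
    (by linarith) _ _ (fun j : ℕ ↦ (n : ℝ) - 2 * j) (fun j _ h ↦ (hy j h).elim),
    sum_range_eq_two_mul_of_symm]
  · push_cast
    rw [Finset.mul_sum, Finset.mul_sum]
    refine Finset.sum_congr rfl fun j hj ↦ ?_
    have hj : 2 * j < n := by
      obtain ⟨m, rfl⟩ := hn
      have := Finset.mem_range.1 hj
      omega
    have hpos : (0 : ℝ) < n - 2 * j := by
      have : (2 * j : ℝ) < n := by exact_mod_cast hj
      linarith
    have hyp : ((n : ℝ) - 2 * j) ^ p =
        ((n : ℝ) - 2 * j) ^ (2 * k) * ((n : ℝ) - 2 * j) * ((n : ℝ) - 2 * j) ^ (q - 1) := by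
      rw [← pow_succ, ← Real.rpow_natCast, ← Real.rpow_add hpos, hq]
      push_cast
      ring_nf
    have hcos : Real.cos (Real.pi * p / 2) = (-1) ^ k * Real.cos (Real.pi * q / 2) := by
      rw [← Real.cos_add_nat_mul_pi, hq]
      ring_nf
    have hsign : ((-1 : ℂ) ^ k)⁻¹ = (-1) ^ k := by rw [← inv_pow]; norm_num
    have hcos' := congrArg (fun z : ℝ ↦ (z : ℂ)) hcos
    push_cast at hcos'
    rw [abs_of_pos hpos, hyp, hcos', div_mul_eq_div_div _ ((-1 : ℂ) ^ k),
      div_eq_mul_inv _ ((-1 : ℂ) ^ k), hsign]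
    push_cast
    ring
  · intro j hj
    obtain ⟨h1, h2, h3⟩ := neg_one_pow_mul_choose_reflect hj
    rw [h1, h2, h3, hn.neg_one_pow, (even_two_mul k).neg_pow]
    ring
  · intro j h
    obtain ⟨m, rfl⟩ := hn
    omega

theorem integral_rpow_mul_sum_of_even {n : ℕ} (hn : Even n) {p : ℝ} (hp : 0 < p) (hpn : p < n)
    (hne : ¬∃ k : ℤ, (n : ℝ) - p = 2 * k) :
    ∫ x in Ioi (0 : ℝ), ((x ^ p : ℝ) : ℂ) *
        ∑ j ∈ Finset.range (n + 1), (-1 : ℂ) ^ j * n.choose j *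
          (1 / (x - ((n : ℂ) - 2 * j) * Complex.I)) =
      -((Real.pi / Real.sin (Real.pi * p / 2) : ℝ) : ℂ) *
        ((∑ j ∈ Finset.range ((n + 1) / 2),
              (-1 : ℝ) ^ j * (n.choose j) * ((n : ℝ) - 2 * j) ^ p : ℝ) : ℂ) := by
  obtain ⟨l, hl⟩ : ∃ l : ℕ, l = ⌊p / 2⌋₊ := ⟨_, rfl⟩
  have hl1 : (l : ℝ) ≤ p / 2 := hl ▸ Nat.floor_le (by linarith)
  have hl2 : p / 2 < l + 1 := hl ▸ Nat.lt_floor_add_one _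
  obtain ⟨k, hk⟩ : ∃ k, k = l + 1 := ⟨_, rfl⟩
  have hk' : (k : ℝ) = l + 1 := by rw [hk]; push_cast; rfl
  obtain ⟨q, hq⟩ : ∃ q, q = p - 2 * k + 1 := ⟨_, rfl⟩
  have hq1 : -1 < q := by
    refine lt_of_le_of_ne (by linarith) fun h ↦ hne ?_
    obtain ⟨m, hm⟩ := hn
    exact ⟨m - l, by rw [hm]; push_cast; linarith⟩
  have hkn : 2 * k ≤ n := by
    have : (2 * l : ℝ) < n := by linarith
    have : 2 * l < n := by exact_mod_cast this
    obtain ⟨m, rfl⟩ := hn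
    omega
  have hy : ∀ j : ℕ, (n : ℝ) - 2 * j = 0 → ((n : ℂ) - 2 * j) ^ (2 * k) = 0 := fun j h0 ↦ by
    have h0' : (n : ℂ) - 2 * j = 0 := by exact_mod_cast congrArg (fun z : ℝ ↦ (z : ℂ)) h0
    rw [h0', zero_pow (by omega)]
  have hI : ∀ x ∈ Ioi (0 : ℝ), ((x ^ p : ℝ) : ℂ) *
        ∑ j ∈ Finset.range (n + 1), (-1 : ℂ) ^ j * n.choose j *
          (1 / (x - ((n : ℂ) - 2 * j) * Complex.I)) =
      ∑ j ∈ Finset.range (n + 1), ((-1 : ℂ) ^ j * n.choose j * (-1) ^ k *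
          ((n : ℂ) - 2 * j) ^ (2 * k)) *
          ((x ^ q / (x ^ 2 + ((n : ℝ) - 2 * j) ^ 2) : ℝ) : ℂ) := by
    intro x hx
    have hx0 : (0 : ℝ) < x := hx
    have hxp : x ^ p = x ^ (q - 1) * x ^ (2 * k) := by
      rw [← Real.rpow_natCast x, ← Real.rpow_add hx0, hq]
      push_cast
      ring_nf
    have hxq : x ^ q = x ^ (q - 1) * x := by
      rw [← Real.rpow_add_one hx0.ne', sub_add_cancel]
    rw [hxp, hxq]
    push_cast
    rw [mul_assoc, pow_two_mul_mul_sum_div n k hkn hx0, if_pos hn, Finset.mul_sum]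
    refine Finset.sum_congr rfl fun j _ ↦ ?_
    ring
  rw [setIntegral_congr_fun measurableSet_Ioi hI, integral_sum_mul_rpow_div_sq_add_sq hq1
    (by linarith) _ _ (fun j : ℕ ↦ (n : ℝ) - 2 * j) (fun j _ h ↦ by rw [hy j h, mul_zero]),
    sum_range_eq_two_mul_of_symm]
  · push_cast
    rw [Finset.mul_sum, Finset.mul_sum]
    refine Finset.sum_congr rfl fun j hj ↦ ?_
    have hj : 2 * j < n := by
      obtain ⟨m, rfl⟩ := hn
      have := Finset.mem_range.1 hj
      omega
    have hpos : (0 : ℝ) < n - 2 * j := by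
      have : (2 * j : ℝ) < n := by exact_mod_cast hj
      linarith
    have hyp : ((n : ℝ) - 2 * j) ^ p =
        ((n : ℝ) - 2 * j) ^ (2 * k) * ((n : ℝ) - 2 * j) ^ (q - 1) := by
      rw [← Real.rpow_natCast, ← Real.rpow_add hpos, hq]
      push_cast
      ring_nf
    have hcos : Real.sin (Real.pi * p / 2) = (-1) ^ k * -Real.cos (Real.pi * q / 2) := by
      rw [← Real.sin_sub_pi_div_two, ← Real.sin_add_nat_mul_pi, hq]
      ring_nf
    have hsign : ((-1 : ℂ) ^ k)⁻¹ = (-1) ^ k := by rw [← inv_pow]; norm_num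
    have hcos' := congrArg (fun z : ℝ ↦ (z : ℂ)) hcos
    push_cast at hcos'
    rw [abs_of_pos hpos, hyp, hcos', div_mul_eq_div_div _ ((-1 : ℂ) ^ k),
      div_eq_mul_inv _ ((-1 : ℂ) ^ k), hsign,
      div_neg]
    push_cast
    ring
  · intro j hj
    obtain ⟨h1, h2, h3⟩ := neg_one_pow_mul_choose_reflect hj
    rw [h1, h2, h3, hn.neg_one_pow, (even_two_mul k).neg_pow]
    ring
  · intro j h
    have : ((n : ℝ) - 2 * j) = 0 := by rw [← h]; push_cast; ring
    rw [hy j this]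
    ring

theorem stmt17 (n : ℕ) (hn : 1 ≤ n) (p : ℝ)
    (hpe : Even n → 0 < p) (hpo : Odd n → -1 < p) (hpn : p < n)
    (hne : ¬∃ k : ℤ, (n : ℝ) - p = 2 * k) :
    Tendsto
      (fun s : ℝ × ℝ =>
        ∫ t in s.1..s.2, (2 * Complex.I * (Real.sin t : ℂ)) ^ n / ((t ^ (p + 1) : ℝ) : ℂ))
      ((𝓝[>] (0:ℝ)) ×ˢ atTop)
      (𝓝 (-(((Real.pi / Real.Gamma (p + 1)) : ℝ) : ℂ) *
        (((∑ j ∈ Finset.range ((n + 1) / 2),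
              (-1 : ℝ) ^ j * (n.choose j) * ((n : ℝ) - 2 * j) ^ p : ℝ) : ℂ) /
          (if Even n then ((Real.sin (Real.pi * p / 2) : ℝ) : ℂ)
            else Complex.I * ((Real.cos (Real.pi * p / 2) : ℝ) : ℂ))))) := by
  have hp : -1 < p := by
    rcases Nat.even_or_odd n with h | h
    · linarith [hpe h]
    · exact hpo h
  have hΓ : (Real.Gamma (p + 1) : ℂ) ≠ 0 :=
    Complex.ofReal_ne_zero.2 (Real.Gamma_pos_of_pos (by linarith)).ne'
  have hlim := (tendsto_integral_rpow_mul_integral_two_I_sin_pow_mul_exp n hpe hpo hpn).const_mul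
    (Real.Gamma (p + 1) : ℂ)⁻¹
  have hlim' := hlim.congr' (f₂ := fun s : ℝ × ℝ ↦
      ∫ t in s.1..s.2, (2 * Complex.I * (Real.sin t : ℂ)) ^ n / ((t ^ (p + 1) : ℝ) : ℂ)) (by
    filter_upwards [eventually_pos_and_le] with s hs
    rw [← Gamma_mul_integral_two_I_sin_pow_div n hp hs.1 hs.2, inv_mul_cancel_left₀ hΓ])
  convert! hlim' using 2
  split_ifs with h
  · rw [integral_rpow_mul_sum_of_even h (hpe h) hpn hne]
    push_cast
    ring
  · rw [integral_rpow_mul_sum_of_odd (Nat.not_even_iff_odd.1 h) hp hpn hne, div_mul_eq_div_div,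
      Complex.div_I]
    push_cast
    ring
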